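/- Let n be an odd composite natural number. If n is a special Carmichael number, then the set of Euler liars for n equals {a ∈ U(Z/nZ) : (a/n) = 1}, and in particular n is an Euler pseudoprime for exactly φ(n)/2 bases. -/

import Mathlib

theorem one_add_pow_of_mul_self_eq_zero {R : Type*} [CommRing R] {x : R} (hx : x * x = 0)
    (k : ℕ) : (1 + x) ^ k = 1 + k * x := by
  induction k with
  | zero => simp
  | succ k ih =>
    rw [pow_succ, ih]
    push_cast
    linear_combination (k : R) * hx

/-- If `n > 1` is odd and every unit modulo `n` is killed by `(n - 1) / 2`, then `n` is
squarefree. -/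
theorem squarefree_of_forall_units_pow_eq_one {n : ℕ} (hn : 1 < n) (hodd : Odd n)
    (h : ∀ a : (ZMod n)ˣ, (a : ZMod n) ^ ((n - 1) / 2) = 1) : Squarefree n := by
  rw [Nat.squarefree_iff_prime_squarefree]
  rintro p hp ⟨m, hm⟩
  have hx : ((p * m : ℕ) : ZMod n) * ((p * m : ℕ) : ZMod n) = 0 := by
    rw [← Nat.cast_mul, ZMod.natCast_eq_zero_iff]
    exact ⟨m, by rw [hm]; ring⟩
  have hk := h ⟨1 + (p * m : ℕ), 1 - (p * m : ℕ), by linear_combination -hx,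
    by linear_combination -hx⟩
  simp only [one_add_pow_of_mul_self_eq_zero hx, add_eq_left] at hk
  rw [← Nat.cast_mul, ZMod.natCast_eq_zero_iff] at hk
  have hpm : 0 < p * m := by
    rcases Nat.eq_zero_or_pos (p * m) with h0 | h0
    · rw [mul_assoc, h0] at hm
      omega
    · exact h0
  have hpk : p ∣ (n - 1) / 2 := by
    refine Nat.dvd_of_mul_dvd_mul_right hpm ?_
    rwa [← mul_assoc, ← hm]
  have hp1 : p ∣ n - 1 := by
    obtain ⟨r, hr⟩ := hodd
    exact hpk.trans ⟨2, by omega⟩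
  have hpn : p ∣ n := ⟨p * m, by rw [hm, mul_assoc]⟩
  have := (Nat.dvd_sub hpn hp1)
  rw [Nat.sub_sub_self hn.le] at this
  exact hp.one_lt.ne' (Nat.dvd_one.mp this)

theorem jacobiSym_val_mul {n : ℕ} (a b : ZMod n) :
    jacobiSym ((a * b).val : ℤ) n = jacobiSym (a.val : ℤ) n * jacobiSym (b.val : ℤ) n := by
  rw [ZMod.val_mul, Int.natCast_mod, ← jacobiSym.mod_left, Nat.cast_mul, jacobiSym.mul_left]

theorem jacobiSym_val_unit {n : ℕ} (a : (ZMod n)ˣ) :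
    jacobiSym ((a : ZMod n).val : ℤ) n = 1 ∨ jacobiSym ((a : ZMod n).val : ℤ) n = -1 :=
  jacobiSym.eq_one_or_neg_one (by
    rw [Int.gcd_natCast_natCast]
    exact ZMod.val_coe_unit_coprime a)

/-- The Jacobi symbol modulo an odd squarefree `n > 1` takes the value `-1`. -/
theorem exists_unit_jacobiSym_eq_neg_one {n : ℕ} (hn : 1 < n) (hodd : Odd n)
    (hsq : Squarefree n) : ∃ a : (ZMod n)ˣ, jacobiSym ((a : ZMod n).val : ℤ) n = -1 := by
  obtain ⟨p, hp, m, rfl⟩ := Nat.exists_prime_and_dvd hn.ne'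
  have := Fact.mk hp
  have hcop : p.Coprime m := Nat.coprime_of_squarefree_mul hsq
  have hp2 : p ≠ 2 := by
    rintro rfl
    exact absurd (Nat.odd_mul.mp hodd).1 (by decide)
  have hm0 : m ≠ 0 := by
    rintro rfl
    simp at hn
  obtain ⟨b, hb⟩ := FiniteField.exists_nonsquare (F := ZMod p) (by rwa [ZMod.ringChar_zmod_n])
  obtain ⟨c, hcp, hcm⟩ := Nat.chineseRemainder hcop b.val 1
  have hJp : jacobiSym (c : ℤ) p = -1 := by
    rw [← jacobiSym.legendreSym.to_jacobiSym, legendreSym.eq_neg_one_iff]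
    have : ((c : ℤ) : ZMod p) = b := by
      rw [Int.cast_natCast, (ZMod.natCast_eq_natCast_iff _ _ _).mpr hcp, ZMod.natCast_zmod_val]
    rwa [this]
  have hJm : jacobiSym (c : ℤ) m = 1 := by
    rw [jacobiSym.mod_left' (a₂ := 1) (by exact_mod_cast hcm), jacobiSym.one_left]
  have hJ : jacobiSym (c : ℤ) (p * m) = -1 := by
    rw [jacobiSym.mul_right' _ hp.ne_zero hm0, hJp, hJm, mul_one]
  have hc : c.Coprime (p * m) := by
    by_contra hne
    have := jacobiSym.eq_zero_iff.mpr
      ⟨mul_ne_zero hp.ne_zero hm0, by rwa [Int.gcd_natCast_natCast]⟩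
    omega
  refine ⟨ZMod.unitOfCoprime c hc, ?_⟩
  rw [ZMod.coe_unitOfCoprime, ZMod.val_natCast, Int.natCast_mod, ← jacobiSym.mod_left, hJ]

/-- If the Jacobi symbol modulo `n` takes the value `-1`, it takes the value `1` on exactly half
of the units. -/
theorem card_units_jacobiSym_eq_one {n : ℕ} [NeZero n] {g : (ZMod n)ˣ}
    (hg : jacobiSym ((g : ZMod n).val : ℤ) n = -1) :
    Nat.card {a : (ZMod n)ˣ // jacobiSym ((a : ZMod n).val : ℤ) n = 1} = n.totient / 2 := by
  have hiff (a : (ZMod n)ˣ) : jacobiSym ((a : ZMod n).val : ℤ) n = 1 ↔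
      ¬ jacobiSym (((Equiv.mulLeft g a : (ZMod n)ˣ) : ZMod n).val : ℤ) n = 1 := by
    rw [Equiv.coe_mulLeft, Units.val_mul, jacobiSym_val_mul, hg]
    rcases jacobiSym_val_unit a with h | h <;> rw [h] <;> decide
  have hcard := Nat.card_congr ((Equiv.mulLeft g).subtypeEquiv
    (q := fun a : (ZMod n)ˣ => ¬ jacobiSym ((a : ZMod n).val : ℤ) n = 1) hiff)
  have hsum := Nat.card_congr
    (Equiv.sumCompl fun a : (ZMod n)ˣ => jacobiSym ((a : ZMod n).val : ℤ) n = 1)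
  rw [Nat.card_sum, ← hcard, Nat.card_eq_fintype_card (α := (ZMod n)ˣ),
    ZMod.card_units_eq_totient] at hsum
  omega


/-- If an odd composite `n` is a special Carmichael number, then the set of
Euler liars for `n` equals `{a ∈ U(ℤ/nℤ) : (a/n) = 1}`, and in particular `n`
is an Euler pseudoprime for exactly `φ(n)/2` bases. -/
theorem stmt_12 (n : ℕ) (hn : 1 < n) (hodd : Odd n) (hcomp : ¬ n.Prime)
    (hspecial : ∀ a : (ZMod n)ˣ, (a : ZMod n) ^ ((n - 1) / 2) = 1) :
    {a : (ZMod n)ˣ |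
        (a : ZMod n) ^ ((n - 1) / 2) = ((jacobiSym ((a : ZMod n).val : ℤ) n : ℤ) : ZMod n)}
      = {a : (ZMod n)ˣ | jacobiSym ((a : ZMod n).val : ℤ) n = 1} ∧
    Nat.card {a : (ZMod n)ˣ //
        (a : ZMod n) ^ ((n - 1) / 2) = ((jacobiSym ((a : ZMod n).val : ℤ) n : ℤ) : ZMod n)}
      = n.totient / 2 := by
  have : NeZero n := ⟨by omega⟩
  have hiff (a : (ZMod n)ˣ) :
      (a : ZMod n) ^ ((n - 1) / 2) = ((jacobiSym ((a : ZMod n).val : ℤ) n : ℤ) : ZMod n) ↔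
        jacobiSym ((a : ZMod n).val : ℤ) n = 1 := by
    rw [hspecial a]
    rcases jacobiSym_val_unit a with h | h
    · rw [h]
      simp
    · have : Fact (2 < n) := ⟨by obtain ⟨r, hr⟩ := hodd; omega⟩
      rw [h]
      simpa using (ZMod.neg_one_ne_one (n := n)).symm
  obtain ⟨g, hg⟩ := exists_unit_jacobiSym_eq_neg_one hn hodd
    (squarefree_of_forall_units_pow_eq_one hn hodd hspecial)
  refine ⟨Set.ext hiff, ?_⟩
  rw [Nat.card_congr (Equiv.subtypeEquivRight hiff)]
  exact card_units_jacobiSym_eq_one hg
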